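/- Let φ : (0,2] → ℝ be twice differentiable satisfying r·φ″(r) + 3·φ′(r) + 2·r²·(φ′(r))³ − (r²/2)·φ′(r) − (r⁴/2)·(φ′(r))³ = 0 for all r ∈ (0,2], together with the Neumann boundary condition φ′(2) = 0. Then φ′(r) = 0 for all r ∈ (0,2], i.e. φ is constant; equivalently, the only static solutions of the rescaled equivariant Lagrangian mean curvature flow with boundary meeting the Clifford torus orthogonally, written radially as γ(r) = r·e^{iφ(r)}, are straight lines through the origin. -/

import Mathlib

theorem Convex.eq_of_hasDerivAt_zero {s : Set ℝ} (hs : Convex ℝ s) {f : ℝ → ℝ}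
    (hf : ∀ x ∈ s, HasDerivAt f 0 x) {x y : ℝ} (hx : x ∈ s) (hy : y ∈ s) : f x = f y := by
  have h := hs.norm_image_sub_le_of_norm_hasDerivWithin_le (C := 0)
    (fun z hz => (hf z hz).hasDerivWithinAt) (fun z _ => by simp) hy hx
  simpa [sub_eq_zero] using h

/-- With `l = r * p`, the quantity `l² / (1 + l²) * r⁴ * exp (-r² / 2)` is a first integral of
`l' + (l + l³) * (2 / r - r / 2) = 0`. -/
theorem hasDerivAt_firstIntegral {p : ℝ → ℝ} {p' r : ℝ} (hp : HasDerivAt p p' r)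
    (hode : r * p' + 3 * p r + 2 * r ^ 2 * p r ^ 3 - r ^ 2 / 2 * p r - r ^ 4 / 2 * p r ^ 3 = 0) :
    HasDerivAt (fun x => (x * p x) ^ 2 / (1 + (x * p x) ^ 2) * (x ^ 4 * Real.exp (-x ^ 2 / 2)))
      0 r := by
  have hl : HasDerivAt (fun x => (x * p x) ^ 2) (2 * (r * p r) * (p r + r * p')) r := by
    exact (((hasDerivAt_id r).mul hp).pow 2).congr_deriv (by simp)
  have hpos : 1 + (r * p r) ^ 2 ≠ 0 := by positivity
  have hw : HasDerivAt (fun x : ℝ => x ^ 4 * Real.exp (-x ^ 2 / 2))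
      (4 * r ^ 3 * Real.exp (-r ^ 2 / 2) + r ^ 4 * (Real.exp (-r ^ 2 / 2) * (-(2 * r) / 2))) r := by
    exact ((hasDerivAt_pow 4 r).mul ((hasDerivAt_pow 2 r).neg.div_const 2).exp).congr_deriv (by simp)
  refine ((hl.div (hl.const_add 1) hpos).mul hw).congr_deriv ?_
  have hp' : r * p' = -(3 * p r + 2 * r ^ 2 * p r ^ 3 - r ^ 2 / 2 * p r - r ^ 4 / 2 * p r ^ 3) := by
    linarith
  rw [hp']
  simp only [Pi.div_apply]
  field_simp
  ring


/-- If `φ` is twice differentiable on `(0,2]`, satisfies the static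
rescaled-flow ODE `rφ″ + 3φ′ + 2r²φ′³ − (r²/2)φ′ − (r⁴/2)φ′³ = 0` on `(0,2]` together with
the Neumann boundary condition `φ′(2) = 0`, then `φ′ ≡ 0` on `(0,2]`, i.e. `φ` is constant:
the only static solutions of the rescaled equivariant Lagrangian mean curvature flow meeting
the Clifford torus orthogonally are straight lines through the origin. -/
theorem stmt15 (φ : ℝ → ℝ)
    (hφ : ∀ r ∈ Set.Ioc (0:ℝ) 2, DifferentiableAt ℝ φ r)
    (hφ' : ∀ r ∈ Set.Ioc (0:ℝ) 2, DifferentiableAt ℝ (deriv φ) r)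
    (hode : ∀ r ∈ Set.Ioc (0:ℝ) 2,
      r * deriv (deriv φ) r + 3 * deriv φ r + 2 * r ^ 2 * deriv φ r ^ 3
        - r ^ 2 / 2 * deriv φ r - r ^ 4 / 2 * deriv φ r ^ 3 = 0)
    (hbc : deriv φ 2 = 0) :
    (∀ r ∈ Set.Ioc (0:ℝ) 2, deriv φ r = 0) ∧
    ∀ r ∈ Set.Ioc (0:ℝ) 2, ∀ s ∈ Set.Ioc (0:ℝ) 2, φ r = φ s := by
  have hφ'_zero : ∀ r ∈ Set.Ioc (0:ℝ) 2, deriv φ r = 0 := by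
    intro r hr
    have h := (convex_Ioc (0:ℝ) 2).eq_of_hasDerivAt_zero
      (fun x hx => hasDerivAt_firstIntegral (hφ' x hx).hasDerivAt (hode x hx)) hr
      (Set.right_mem_Ioc.2 two_pos)
    have hpos : 1 + (r * deriv φ r) ^ 2 ≠ 0 := by positivity
    simpa [hbc, hpos, hr.1.ne'] using h
  refine ⟨hφ'_zero, fun r hr s hs => (convex_Ioc (0:ℝ) 2).eq_of_hasDerivAt_zero ?_ hr hs⟩
  intro x hx
  simpa only [hφ'_zero x hx] using (hφ x hx).hasDerivAt
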